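/- arXiv:1503.08517 — 2 statements merged into one kernel-verified Lean document; each statement's English description precedes it below -/
import Mathlib

section
/- Let Λ be a row-finite k-graph with no sources and suppose that Λ is not strongly aperiodic. Then there exists a hereditary and saturated subset H ⊆ Λ⁰ (possibly empty, and necessarily proper) such that: (1) the vertex set (Λ\ΛH)⁰ = Λ⁰ \ H is a maximal tail of the k-graph Λ\ΛH; and (2) there exist a vertex w ∈ Λ⁰ \ H and m ≠ n in ℕ^k such that σ^m(y) = σ^n(y) for every infinite path y of Λ\ΛH with r(y) = w (that is, the periodicity group Per(Λ\ΛH) is nontrivial). -/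
/-- A `k`-graph: a countable small category `Λ` (with morphism set `Mor`, range map `r`,
source map `s` and composition `comp`; the objects/vertices are identified with the
identity morphisms, which are exactly the morphisms of degree `0`) together with a degree
functor `d : Λ → ℕ^k` satisfying the factorisation property. -/
structure KGraph (k : ℕ) where
  /-- The set of morphisms. -/
  Mor : Type
  /-- A `k`-graph is countable. -/
  countable : Countable Mor
  /-- The degree functor `d : Λ → ℕ^k`. -/
  d : Mor → Fin k → ℕ
  /-- The range (codomain) of a morphism, as an identity morphism. -/
  r : Mor → Mor
  /-- The source (domain) of a morphism, as an identity morphism. -/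
  s : Mor → Mor
  /-- Composition `μν` of morphisms with `s μ = r ν`. -/
  comp : (μ ν : Mor) → s μ = r ν → Mor
  d_r : ∀ lam, d (r lam) = 0
  d_s : ∀ lam, d (s lam) = 0
  r_vertex : ∀ v, d v = 0 → r v = v
  s_vertex : ∀ v, d v = 0 → s v = v
  r_comp : ∀ μ ν h, r (comp μ ν h) = r μ
  s_comp : ∀ μ ν h, s (comp μ ν h) = s ν
  d_comp : ∀ μ ν h, d (comp μ ν h) = d μ + d ν
  comp_assoc : ∀ lam μ ν (h₁ : s lam = r μ) (h₂ : s μ = r ν) h₃ h₄,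
    comp (comp lam μ h₁) ν h₃ = comp lam (comp μ ν h₂) h₄
  id_comp : ∀ lam, comp (r lam) lam (s_vertex (r lam) (d_r lam)) = lam
  comp_id : ∀ lam, comp lam (s lam) (Eq.symm (r_vertex (s lam) (d_s lam))) = lam
  /-- The factorisation property. -/
  factor : ∀ (lam : Mor) (m n : Fin k → ℕ), d lam = m + n →
    ∃! μν : Mor × Mor, ∃ h : s μν.1 = r μν.2,
      d μν.1 = m ∧ d μν.2 = n ∧ comp μν.1 μν.2 h = lam

namespace KGraph

variable {k : ℕ} (Λ : KGraph k)

/-- The vertices of a `k`-graph: the morphisms of degree `0`. -/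
def vertices : Set Λ.Mor := {v | Λ.d v = 0}

/-- `Λ` is row-finite if each vertex receives finitely many paths of each degree. -/
def RowFinite : Prop :=
  ∀ v n, Λ.d v = 0 → {lam : Λ.Mor | Λ.r lam = v ∧ Λ.d lam = n}.Finite

/-- `Λ` has no sources if every vertex receives an edge of each of the `k` colours. -/
def NoSources : Prop :=
  ∀ v, Λ.d v = 0 → ∀ i : Fin k, ∃ e : Λ.Mor, Λ.r e = v ∧ Λ.d e = Pi.single i 1

/-- An infinite path in `Λ`: a degree-preserving functor `x : Ω_k → Λ`, recorded by its
segments `x(m, n)` for `m ≤ n` in `ℕ^k`. -/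
structure InfPath where
  /-- The segment `x(m,n)` of the path, for `m ≤ n`. -/
  seg : (m n : Fin k → ℕ) → m ≤ n → Λ.Mor
  deg_seg : ∀ m n h, Λ.d (seg m n h) = fun i => n i - m i
  r_seg : ∀ m n h, Λ.r (seg m n h) = seg m m le_rfl
  s_seg : ∀ m n h, Λ.s (seg m n h) = seg n n le_rfl
  comp_seg : ∀ m n p (h₁ : m ≤ n) (h₂ : n ≤ p),
    seg m p (h₁.trans h₂) =
      Λ.comp (seg m n h₁) (seg n p h₂) (by rw [s_seg, r_seg])

variable {Λ}

/-- The shift `σ^p x` of an infinite path. -/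
def InfPath.shift (x : Λ.InfPath) (p : Fin k → ℕ) : Λ.InfPath where
  seg m n h := x.seg (m + p) (n + p) (fun i => Nat.add_le_add_right (h i) (p i))
  deg_seg m n h := by
    rw [x.deg_seg]
    funext i
    simp only [Pi.add_apply]
    omega
  r_seg m n h := x.r_seg _ _ _
  s_seg m n h := x.s_seg _ _ _
  comp_seg m n p h₁ h₂ := x.comp_seg _ _ _ _ _

/-- The range `r(x) = x(0)` of an infinite path. -/
def InfPath.range (x : Λ.InfPath) : Λ.Mor := x.seg 0 0 le_rfl

/-- The vertex `x(p)` of an infinite path. -/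
def InfPath.vertex (x : Λ.InfPath) (p : Fin k → ℕ) : Λ.Mor := x.seg p p le_rfl


variable (Λ)

/-- A subset `H ⊆ Λ⁰` is hereditary if `s(λ) ∈ H` whenever `r(λ) ∈ H`. -/
def Hereditary (H : Set Λ.Mor) : Prop := ∀ lam, Λ.r lam ∈ H → Λ.s lam ∈ H

/-- A subset `H ⊆ Λ⁰` is saturated if `v ∈ H` whenever for some colour `i` the sources of
all edges of degree `e_i` received by `v` lie in `H`. -/
def Saturated (H : Set Λ.Mor) : Prop :=
  ∀ v, Λ.d v = 0 →
    (∃ i : Fin k, ∀ lam, Λ.r lam = v → Λ.d lam = Pi.single i 1 → Λ.s lam ∈ H) → v ∈ H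

variable {Λ}

/-- An infinite path lies in the subgraph `Λ \ ΛH` iff all of its vertices avoid `H`. -/
def InfPath.Avoids (x : Λ.InfPath) (H : Set Λ.Mor) : Prop := ∀ p, x.vertex p ∉ H

variable (Λ)

/-- Aperiodicity of the quotient graph `Λ \ ΛH`: every vertex outside `H` receives an
infinite path in `Λ \ ΛH` all of whose shifts are pairwise distinct. -/
def AperiodicQuot (H : Set Λ.Mor) : Prop :=
  ∀ v, Λ.d v = 0 → v ∉ H →
    ∃ x : Λ.InfPath, x.Avoids H ∧ x.range = v ∧
      ∀ m n : Fin k → ℕ, m ≠ n → x.shift m ≠ x.shift n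

/-- `Λ` is strongly aperiodic if `Λ \ ΛH` is aperiodic for every proper hereditary
saturated subset `H ⊊ Λ⁰`. -/
def StronglyAperiodic : Prop :=
  ∀ H : Set Λ.Mor, H ⊆ Λ.vertices → Λ.Hereditary H → Λ.Saturated H →
    H ≠ Λ.vertices → Λ.AperiodicQuot H

/-- `T` is a maximal tail of the quotient graph `Λ \ ΛH`: a nonempty set of vertices of
`Λ \ ΛH` satisfying conditions (a), (b), (c), with all morphisms taken in `Λ \ ΛH`
(i.e. morphisms `λ` of `Λ` with `s(λ) ∉ H`). -/
def MaximalTailQuot (H T : Set Λ.Mor) : Prop :=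
  T.Nonempty ∧ (∀ v ∈ T, Λ.d v = 0 ∧ v ∉ H) ∧
  (∀ v₁ ∈ T, ∀ v₂ ∈ T, ∃ w ∈ T,
    (∃ lam, Λ.s lam ∉ H ∧ Λ.r lam = v₁ ∧ Λ.s lam = w) ∧
    (∃ lam, Λ.s lam ∉ H ∧ Λ.r lam = v₂ ∧ Λ.s lam = w)) ∧
  (∀ v ∈ T, ∀ i : Fin k,
    ∃ e, Λ.s e ∉ H ∧ Λ.r e = v ∧ Λ.d e = Pi.single i 1 ∧ Λ.s e ∈ T) ∧
  (∀ w ∈ T, ∀ v, Λ.d v = 0 → v ∉ H →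
    (∃ lam, Λ.s lam ∉ H ∧ Λ.r lam = v ∧ Λ.s lam = w) → v ∈ T)

variable {Λ}

theorem comp_inj {α β α' β' : Λ.Mor} (h : Λ.s α = Λ.r β) (h' : Λ.s α' = Λ.r β')
    (hd : Λ.d α = Λ.d α') (he : Λ.comp α β h = Λ.comp α' β' h') : α = α' ∧ β = β' := by
  have hβ : Λ.d β' = Λ.d β := by
    have := congrArg Λ.d he
    rw [Λ.d_comp, Λ.d_comp, hd] at this
    exact (add_left_cancel this).symm
  have := (Λ.factor (Λ.comp α β h) (Λ.d α) (Λ.d β) (Λ.d_comp _ _ _)).unique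
    (y₁ := (α, β)) (y₂ := (α', β')) ⟨h, rfl, rfl, rfl⟩ ⟨h', hd.symm, hβ, he.symm⟩
  exact Prod.ext_iff.mp this

theorem comp_left_cancel {α β β' : Λ.Mor} (h : Λ.s α = Λ.r β) (h' : Λ.s α = Λ.r β')
    (he : Λ.comp α β h = Λ.comp α β' h') : β = β' :=
  (comp_inj h h' rfl he).2

/-- `α` is an initial segment of `lam`. -/
def IsInitial (α lam : Λ.Mor) : Prop := ∃ β, ∃ h : Λ.s α = Λ.r β, Λ.comp α β h = lam

theorem IsInitial.refl (α : Λ.Mor) : IsInitial α α := ⟨_, _, Λ.comp_id α⟩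

theorem IsInitial.trans {α β γ : Λ.Mor} (h₁ : IsInitial α β) (h₂ : IsInitial β γ) :
    IsInitial α γ := by
  obtain ⟨μ, hμ, rfl⟩ := h₁
  obtain ⟨ν, hν, rfl⟩ := h₂
  have h : Λ.s μ = Λ.r ν := by rw [← hν, Λ.s_comp]
  exact ⟨Λ.comp μ ν h, by rw [Λ.r_comp, hμ], (Λ.comp_assoc _ _ _ _ _ _ _).symm⟩

theorem IsInitial.eq_of_d_eq {α α' lam : Λ.Mor} (h : IsInitial α lam) (h' : IsInitial α' lam)
    (hd : Λ.d α = Λ.d α') : α = α' := by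
  obtain ⟨μ, hμ, rfl⟩ := h
  obtain ⟨ν, hν, he⟩ := h'
  exact (comp_inj hμ hν hd he.symm).1

theorem exists_isInitial (lam : Λ.Mor) {n : Fin k → ℕ} (hn : n ≤ Λ.d lam) :
    ∃ α, IsInitial α lam ∧ Λ.d α = n := by
  obtain ⟨⟨α, β⟩, ⟨h, hα, -, he⟩, -⟩ :=
    Λ.factor lam n (Λ.d lam - n) (add_tsub_cancel_of_le hn).symm
  exact ⟨α, ⟨β, h, he⟩, hα⟩

/-- A coherent family of initial segments, one of each degree, defines an infinite path. -/
theorem exists_infPath_of_initial (f : (Fin k → ℕ) → Λ.Mor) (hd : ∀ n, Λ.d (f n) = n)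
    (hf : ∀ m n, m ≤ n → IsInitial (f m) (f n)) :
    ∃ x : Λ.InfPath, ∀ n, x.seg 0 n zero_le = f n := by
  choose g hg hfg using hf
  have hself : ∀ m, g m m le_rfl = Λ.s (f m) := fun m =>
    comp_left_cancel (hg m m le_rfl) (Λ.r_vertex _ (Λ.d_s _)).symm
      ((hfg m m le_rfl).trans (Λ.comp_id _).symm)
  have hs : ∀ m n h, Λ.s (g m n h) = Λ.s (f n) := fun m n h => by
    conv_rhs => rw [← hfg m n h, Λ.s_comp]
  refine ⟨⟨g, ?_, ?_, ?_, ?_⟩, ?_⟩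
  · intro m n h
    have := congrArg Λ.d (hfg m n h)
    rw [Λ.d_comp, hd, hd] at this
    funext i
    have := congrFun this i
    simp only [Pi.add_apply] at this
    omega
  · intro m n h
    rw [hself, hg m n h]
  · intro m n h
    rw [hself, hs]
  · intro m n p h₁ h₂
    have hc : Λ.s (g m n h₁) = Λ.r (g n p h₂) := by rw [hs, hg]
    have hm : Λ.s (f m) = Λ.r (Λ.comp (g m n h₁) (g n p h₂) hc) := by rw [Λ.r_comp, hg]
    refine comp_left_cancel (hg m p _) hm ?_
    rw [hfg, ← Λ.comp_assoc (f m) (g m n h₁) (g n p h₂) (hg m n h₁) hc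
      (by rw [Λ.s_comp, hc])]
    simp only [hfg]
  · intro n
    have h0 : Λ.r (f n) = f 0 := by
      conv_lhs => rw [← hfg 0 n zero_le, Λ.r_comp, Λ.r_vertex _ (hd 0)]
    refine comp_left_cancel (α := Λ.r (f n)) (by rw [h0]; exact hg 0 n _)
      (Λ.s_vertex _ (Λ.d_r _)) ?_
    rw [Λ.id_comp]
    simp only [h0, hfg]

theorem exists_infPath_of_chain (L : ℕ → Λ.Mor) (hL : ∀ j, IsInitial (L j) (L (j + 1)))
    (hd : ∀ j i, j ≤ Λ.d (L j) i) :
    ∃ x : Λ.InfPath, ∀ j, x.seg 0 (Λ.d (L j)) zero_le = L j := by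
  have hmono : ∀ i j, i ≤ j → IsInitial (L i) (L j) := fun i j hij =>
    Nat.le_induction (IsInitial.refl _) (fun j _ ih => ih.trans (hL j)) j hij
  have hbig : ∀ n : Fin k → ℕ, n ≤ Λ.d (L (∑ i, n i)) := fun n i =>
    (Finset.single_le_sum (fun _ _ => Nat.zero_le _) (Finset.mem_univ i)).trans (hd _ i)
  choose f hf hfd using fun n => exists_isInitial (L (∑ i, n i)) (hbig n)
  obtain ⟨x, hx⟩ := exists_infPath_of_initial f hfd (by
    intro m n hmn
    obtain ⟨α, hα, hαd⟩ := exists_isInitial (f n) (hmn.trans_eq (hfd n).symm)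
    have hsum : ∑ i, m i ≤ ∑ i, n i := Finset.sum_le_sum fun i _ => hmn i
    have : f m = α := ((hf m).trans (hmono _ _ hsum)).eq_of_d_eq (hα.trans (hf n))
      ((hfd m).trans hαd.symm)
    rwa [this])
  refine ⟨x, fun j => ?_⟩
  rw [hx]
  exact ((hf _).trans (hmono _ _ (le_max_left _ j))).eq_of_d_eq (hmono _ _ (le_max_right _ j))
    (hfd _)

theorem InfPath.seg_eq_of_seg_zero_eq (x y : Λ.InfPath) {q u v : Fin k → ℕ}
    (hq : x.seg 0 q zero_le = y.seg 0 q zero_le) (huv : u ≤ v) (hv : v ≤ q) :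
    x.seg u v huv = y.seg u v huv := by
  have h0 : x.seg 0 v zero_le = y.seg 0 v zero_le := by
    rw [x.comp_seg 0 v q zero_le hv, y.comp_seg 0 v q zero_le hv] at hq
    exact (comp_inj _ _ (by rw [x.deg_seg, y.deg_seg]) hq).1
  rw [x.comp_seg 0 u v zero_le huv, y.comp_seg 0 u v zero_le huv] at h0
  exact (comp_inj _ _ (by rw [x.deg_seg, y.deg_seg]) h0).2

/-- An infinite path built by successively appending paths of `Λ \ ΛH` with prescribed
properties. -/
theorem exists_infPath_of_step {H : Set Λ.Mor} (hH : Λ.Hereditary H)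
    {P : ℕ → Λ.Mor → Prop}
    (hP : ∀ j w, Λ.d w = 0 → w ∉ H →
      ∃ μ, Λ.r μ = w ∧ Λ.s μ ∉ H ∧ (∀ i, 1 ≤ Λ.d μ i) ∧ P j μ)
    {v : Λ.Mor} (hv : Λ.d v = 0) (hvH : v ∉ H) :
    ∃ x : Λ.InfPath, x.Avoids H ∧ x.range = v ∧
      ∀ j, ∃ a b, ∃ h : a ≤ b, P j (x.seg a b h) := by
  choose μ hr hs h1 hμ using hP
  let L : ℕ → {lam : Λ.Mor // Λ.s lam ∉ H} := fun j =>
    Nat.rec ⟨v, by rwa [Λ.s_vertex v hv]⟩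
      (fun j lam => ⟨Λ.comp lam.1 (μ j (Λ.s lam.1) (Λ.d_s _) lam.2) (hr _ _ _ _).symm,
        by rw [Λ.s_comp]; exact hs _ _ _ _⟩) j
  have hL : ∀ j, (L (j + 1)).1 =
      Λ.comp (L j).1 (μ j (Λ.s (L j).1) (Λ.d_s _) (L j).2) (hr _ _ _ _).symm := fun j => rfl
  have hdL : ∀ j, Λ.d (L (j + 1)).1 =
      Λ.d (L j).1 + Λ.d (μ j (Λ.s (L j).1) (Λ.d_s _) (L j).2) := fun j => by
    rw [hL, Λ.d_comp]
  have hbig : ∀ j i, j ≤ Λ.d (L j).1 i := by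
    intro j i
    induction j with
    | zero => exact Nat.zero_le _
    | succ j ih =>
      rw [hdL]
      exact Nat.add_le_add ih (h1 _ _ _ _ i)
  obtain ⟨x, hx⟩ := exists_infPath_of_chain (fun j => (L j).1) (fun j => ⟨_, _, (hL j).symm⟩) hbig
  refine ⟨x, ?_, ?_, ?_⟩
  · intro p hp
    have hle : p ≤ Λ.d (L (∑ i, p i)).1 := fun i =>
      (Finset.single_le_sum (fun _ _ => Nat.zero_le _) (Finset.mem_univ i)).trans (hbig _ i)
    have h := hH (x.seg p _ hle) (by rw [x.r_seg]; exact hp)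
    rw [x.s_seg, ← x.s_seg 0 _ zero_le, hx] at h
    exact (L _).2 h
  · have h := congrArg Λ.r (hx 0)
    rw [x.r_seg] at h
    exact h.trans (Λ.r_vertex v hv)
  · intro j
    have hle : Λ.d (L j).1 ≤ Λ.d (L (j + 1)).1 := by rw [hdL]; exact le_self_add
    refine ⟨_, _, hle, ?_⟩
    have h := x.comp_seg 0 _ _ zero_le hle
    have h' : x.seg _ _ hle = μ j (Λ.s (L j).1) (Λ.d_s _) (L j).2 := by
      refine (comp_inj _ (hr _ _ _ _).symm ?_ (h.symm.trans ((hx (j + 1)).trans (hL j)))).2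
      rw [hx]
    rw [h']
    exact hμ _ _ _ _

/-- In `Λ \ ΛH`, every vertex receives a path containing edges of all colours. -/
theorem exists_path_one_le_d {H : Set Λ.Mor} (hH : Λ.Saturated H) {w : Λ.Mor}
    (hw : Λ.d w = 0) (hwH : w ∉ H) :
    ∃ μ, Λ.r μ = w ∧ Λ.s μ ∉ H ∧ ∀ i, 1 ≤ Λ.d μ i := by
  suffices ∀ S : Finset (Fin k), ∃ μ, Λ.r μ = w ∧ Λ.s μ ∉ H ∧ ∀ i ∈ S, 1 ≤ Λ.d μ i by
    simpa using this Finset.univ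
  intro S
  induction S using Finset.induction_on with
  | empty => exact ⟨w, Λ.r_vertex w hw, by rwa [Λ.s_vertex w hw], by simp⟩
  | insert i S _ ih =>
    obtain ⟨μ, hr, hs, hd⟩ := ih
    obtain ⟨e, he, hde, hse⟩ : ∃ e, Λ.r e = Λ.s μ ∧ Λ.d e = Pi.single i 1 ∧ Λ.s e ∉ H := by
      by_contra! hcon
      exact hs (hH _ (Λ.d_s μ) ⟨i, hcon⟩)
    refine ⟨Λ.comp μ e he.symm, by rw [Λ.r_comp, hr], by rwa [Λ.s_comp], ?_⟩
    intro l hl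
    rw [Λ.d_comp, hde, Pi.add_apply]
    rcases Finset.mem_insert.mp hl with rfl | hl
    · simp
    · exact (hd l hl).trans le_self_add

theorem InfPath.exists_seg_ne {x y : Λ.InfPath} (h : x ≠ y) :
    ∃ u v, ∃ huv : u ≤ v, x.seg u v huv ≠ y.seg u v huv := by
  by_contra! hcon
  apply h
  obtain ⟨f, _, _, _, _⟩ := x
  obtain ⟨g, _, _, _, _⟩ := y
  obtain rfl : f = g := by
    funext u v huv
    exact hcon u v huv
  rfl

/-- If no vertex of `Λ \ ΛH` has local periodicity, then `Λ \ ΛH` is aperiodic. -/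
theorem aperiodicQuot_of_no_local_periodicity {H : Set Λ.Mor} (hher : Λ.Hereditary H)
    (hsat : Λ.Saturated H)
    (h : ∀ w, Λ.d w = 0 → w ∉ H → ∀ m n : Fin k → ℕ, m ≠ n →
      ∃ y : Λ.InfPath, y.Avoids H ∧ y.range = w ∧ y.shift m ≠ y.shift n) :
    Λ.AperiodicQuot H := by
  intro v hv hvH
  obtain ⟨e, he⟩ := exists_surjective_nat ((Fin k → ℕ) × (Fin k → ℕ))
  have step : ∀ j w, Λ.d w = 0 → w ∉ H →
      ∃ μ, Λ.r μ = w ∧ Λ.s μ ∉ H ∧ (∀ i, 1 ≤ Λ.d μ i) ∧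
        ((e j).1 ≠ (e j).2 → ∃ y : Λ.InfPath, ∃ q, μ = y.seg 0 q zero_le ∧
          ∃ a b, ∃ hab : a ≤ b, b + (e j).1 ≤ q ∧ b + (e j).2 ≤ q ∧
            (y.shift (e j).1).seg a b hab ≠ (y.shift (e j).2).seg a b hab) := by
    intro j w hw hwH
    by_cases hj : (e j).1 = (e j).2
    · obtain ⟨μ, h1, h2, h3⟩ := exists_path_one_le_d hsat hw hwH
      exact ⟨μ, h1, h2, h3, fun h => absurd hj h⟩
    · obtain ⟨y, hyH, hyr, hy⟩ := h w hw hwH _ _ hj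
      obtain ⟨a, b, hab, hne⟩ := InfPath.exists_seg_ne hy
      refine ⟨y.seg 0 (b + (e j).1 + (e j).2 + 1) zero_le, ?_, ?_, ?_, fun _ =>
        ⟨y, _, rfl, a, b, hab, ?_, ?_, hne⟩⟩
      · rw [y.r_seg]
        exact hyr
      · rw [y.s_seg]
        exact hyH _
      · intro i
        rw [y.deg_seg]
        simp
      all_goals
        intro i
        simp only [Pi.add_apply, Pi.one_apply]
        omega
  obtain ⟨x, hxH, hxr, hx⟩ := exists_infPath_of_step hher step hv hvH
  refine ⟨x, hxH, hxr, fun m n hmn heq => ?_⟩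
  obtain ⟨j, hj⟩ := he (m, n)
  obtain ⟨c, c', hcc, hc⟩ := hx j
  rw [hj] at hc
  obtain ⟨y, q, hq, a, b, hab, hm, hn, hne⟩ := hc hmn
  have hc' : c' = q + c := by
    have := congrArg Λ.d hq
    rw [x.deg_seg, y.deg_seg] at this
    funext i
    have h1 := congrFun this i
    have h2 : c i ≤ c' i := hcc i
    simp only [Pi.zero_apply] at h1
    simp only [Pi.add_apply]
    omega
  subst hc'
  have hseg : (x.shift c).seg 0 q zero_le = y.seg 0 q zero_le := by
    rw [← hq]
    simp only [InfPath.shift, zero_add]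
  apply hne
  have key : ∀ p, b + p ≤ q → (y.shift p).seg a b hab =
      (x.shift p).seg (a + c) (b + c) (add_le_add_left hab c) := by
    intro p hp
    have := (x.shift c).seg_eq_of_seg_zero_eq y hseg (add_le_add_left hab p) hp
    refine this.symm.trans ?_
    simp only [InfPath.shift, add_right_comm]
  rw [key m hm, key n hn, heq]

theorem IsInitial.r_eq {α lam : Λ.Mor} (h : IsInitial α lam) : Λ.r lam = Λ.r α := by
  obtain ⟨β, hβ, rfl⟩ := h
  exact Λ.r_comp _ _ _

/-- The vertices that connect to a vertex on the infinite path `x`. -/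
def InfPath.tail (x : Λ.InfPath) : Set Λ.Mor :=
  {v | ∃ lam p, Λ.r lam = v ∧ Λ.s lam = x.vertex p}

theorem InfPath.tail_subset_vertices (x : Λ.InfPath) : x.tail ⊆ Λ.vertices := by
  rintro _ ⟨lam, p, rfl, -⟩
  exact Λ.d_r lam

theorem InfPath.d_vertex (x : Λ.InfPath) (p : Fin k → ℕ) : Λ.d (x.vertex p) = 0 := by
  rw [InfPath.vertex, ← x.r_seg p p le_rfl]
  exact Λ.d_r _

theorem InfPath.vertex_mem_tail (x : Λ.InfPath) (p : Fin k → ℕ) : x.vertex p ∈ x.tail :=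
  ⟨x.vertex p, p, Λ.r_vertex _ (x.d_vertex p), Λ.s_vertex _ (x.d_vertex p)⟩

theorem InfPath.r_mem_tail (x : Λ.InfPath) {lam : Λ.Mor} (h : Λ.s lam ∈ x.tail) :
    Λ.r lam ∈ x.tail := by
  obtain ⟨μ, p, hr, hs⟩ := h
  exact ⟨Λ.comp lam μ hr.symm, p, Λ.r_comp _ _ _, by rw [Λ.s_comp, hs]⟩

theorem InfPath.exists_path_to_vertex (x : Λ.InfPath) {lam : Λ.Mor} {p q : Fin k → ℕ}
    (h : Λ.s lam = x.vertex p) (hpq : p ≤ q) :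
    ∃ μ, Λ.r μ = Λ.r lam ∧ Λ.s μ = x.vertex q ∧ Λ.d μ = Λ.d lam + (q - p) := by
  refine ⟨Λ.comp lam (x.seg p q hpq) (by rw [x.r_seg, h, InfPath.vertex]),
    Λ.r_comp _ _ _, ?_, ?_⟩
  · rw [Λ.s_comp, x.s_seg, InfPath.vertex]
  · rw [Λ.d_comp, x.deg_seg]
    rfl

theorem InfPath.exists_edge_mem_tail (x : Λ.InfPath) {v : Λ.Mor} (hv : v ∈ x.tail)
    (i : Fin k) : ∃ e, Λ.r e = v ∧ Λ.d e = Pi.single i 1 ∧ Λ.s e ∈ x.tail := by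
  obtain ⟨lam, p, rfl, hs⟩ := hv
  obtain ⟨μ, hr, hμ, hd⟩ :=
    x.exists_path_to_vertex hs (le_self_add : p ≤ p + Pi.single i 1)
  rw [add_tsub_cancel_left] at hd
  obtain ⟨e, he, hde⟩ := exists_isInitial μ (n := Pi.single i 1) (by rw [hd]; exact le_add_self)
  refine ⟨e, by rw [← he.r_eq, hr], hde, ?_⟩
  obtain ⟨ν, h, rfl⟩ := he
  rw [h]
  exact ⟨ν, _, rfl, by rw [← hμ, Λ.s_comp]⟩

theorem InfPath.hereditary_compl_tail (x : Λ.InfPath) :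
    Λ.Hereditary (Λ.vertices \ x.tail) :=
  fun lam h => ⟨Λ.d_s lam, fun hs => h.2 (x.r_mem_tail hs)⟩

theorem InfPath.saturated_compl_tail (x : Λ.InfPath) :
    Λ.Saturated (Λ.vertices \ x.tail) := by
  rintro v hv ⟨i, hi⟩
  refine ⟨hv, fun hvT => ?_⟩
  obtain ⟨e, hr, hd, hs⟩ := x.exists_edge_mem_tail hvT i
  exact (hi e hr hd).2 hs

theorem InfPath.maximalTailQuot_tail (x : Λ.InfPath) :
    Λ.MaximalTailQuot (Λ.vertices \ x.tail) x.tail := by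
  refine ⟨⟨_, x.vertex_mem_tail 0⟩, fun v hv => ⟨x.tail_subset_vertices hv, fun h => h.2 hv⟩,
    ?_, ?_, ?_⟩
  · rintro _ ⟨lam₁, p₁, rfl, h₁⟩ _ ⟨lam₂, p₂, rfl, h₂⟩
    obtain ⟨μ₁, hr₁, hs₁, -⟩ := x.exists_path_to_vertex h₁ (le_sup_left : p₁ ≤ p₁ ⊔ p₂)
    obtain ⟨μ₂, hr₂, hs₂, -⟩ := x.exists_path_to_vertex h₂ (le_sup_right : p₂ ≤ p₁ ⊔ p₂)
    have hmem := x.vertex_mem_tail (p₁ ⊔ p₂)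
    exact ⟨_, hmem, ⟨μ₁, fun h => h.2 (hs₁ ▸ hmem), hr₁, hs₁⟩,
      ⟨μ₂, fun h => h.2 (hs₂ ▸ hmem), hr₂, hs₂⟩⟩
  · intro v hv i
    obtain ⟨e, hr, hd, hs⟩ := x.exists_edge_mem_tail hv i
    exact ⟨e, fun h => h.2 hs, hr, hd, hs⟩
  · rintro w hw v hv hvT -
    by_contra hcon
    exact hvT ⟨hv, hcon⟩

theorem InfPath.notMem_of_mem_tail {H : Set Λ.Mor} (hH : Λ.Hereditary H) {x : Λ.InfPath}
    (hx : x.Avoids H) {v : Λ.Mor} (hv : v ∈ x.tail) : v ∉ H := by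
  obtain ⟨lam, p, rfl, hs⟩ := hv
  exact fun h => hx p (hs ▸ hH lam h)

variable (Λ)

/-- Let `Λ` be a row-finite `k`-graph with no sources which is not
strongly aperiodic.  Then there is a hereditary saturated proper subset `H ⊆ Λ⁰`
(possibly empty) such that (1) the vertex set `Λ⁰ \ H` of `Λ \ ΛH` is a maximal tail of
`Λ \ ΛH`, and (2) there are a vertex `w ∈ Λ⁰ \ H` and `m ≠ n` in `ℕ^k` with
`σ^m(y) = σ^n(y)` for every infinite path `y` of `Λ \ ΛH` with `r(y) = w` (so the
periodicity group of `Λ \ ΛH` is nontrivial). -/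
theorem exists_hereditary_saturated_maximalTail_with_periodicity
    {k : ℕ} (Λ : KGraph k) (hrf : Λ.RowFinite) (hns : Λ.NoSources)
    (hnsa : ¬ Λ.StronglyAperiodic) :
    ∃ H : Set Λ.Mor, H ⊆ Λ.vertices ∧ Λ.Hereditary H ∧ Λ.Saturated H ∧
      H ≠ Λ.vertices ∧
      Λ.MaximalTailQuot H (Λ.vertices \ H) ∧
      ∃ w, Λ.d w = 0 ∧ w ∉ H ∧
        ∃ m n : Fin k → ℕ, m ≠ n ∧
          ∀ y : Λ.InfPath, y.Avoids H → y.range = w → y.shift m = y.shift n := by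
  obtain ⟨H, hHv, hher, hsat, -, hnap⟩ : ∃ H : Set Λ.Mor, H ⊆ Λ.vertices ∧ Λ.Hereditary H ∧
      Λ.Saturated H ∧ H ≠ Λ.vertices ∧ ¬ Λ.AperiodicQuot H := by
    unfold StronglyAperiodic at hnsa
    push Not at hnsa
    exact hnsa
  obtain ⟨w, hw, hwH, m, n, hmn, hper⟩ : ∃ w, Λ.d w = 0 ∧ w ∉ H ∧ ∃ m n : Fin k → ℕ, m ≠ n ∧
      ∀ y : Λ.InfPath, y.Avoids H → y.range = w → y.shift m = y.shift n := by
    by_contra! hcon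
    exact hnap (aperiodicQuot_of_no_local_periodicity hher hsat hcon)
  obtain ⟨x, hxH, hxw, -⟩ := exists_infPath_of_step hher (P := fun _ _ => True)
    (fun _ _ hu huH => by simpa using exists_path_one_le_d hsat hu huH) hw hwH
  have hwT : w ∈ x.tail := hxw ▸ x.vertex_mem_tail 0
  refine ⟨Λ.vertices \ x.tail, Set.sdiff_subset, x.hereditary_compl_tail,
    x.saturated_compl_tail, fun h => (h.symm ▸ hw : w ∈ Λ.vertices \ x.tail).2 hwT, ?_,
    w, hw, fun h => h.2 hwT, m, n, hmn, fun y hy hyw => hper y (fun p hp => hy p ?_) hyw⟩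
  · rw [Set.sdiff_sdiff_cancel_left x.tail_subset_vertices]
    exact x.maximalTailQuot_tail
  · exact ⟨hHv hp, fun hT => InfPath.notMem_of_mem_tail hher hxH hT hp⟩

end KGraph
end

section
/- Let Λ be a row-finite k-graph with no sources and let x ∈ Λ^∞ be an infinite path. Define the shift-tail equivalence class [x] := { λ·σ^p(x) : p ∈ ℕ^k, λ ∈ Λ with s(λ) = x(p) }. Then T := { r(y) : y ∈ [x] } is a maximal tail of Λ; that is: (a) for all v₁, v₂ ∈ T there exists w ∈ T with v₁Λw ≠ ∅ and v₂Λw ≠ ∅; (b) for every v ∈ T and every 1 ≤ i ≤ k there exists e ∈ vΛ^{e_i} with s(e) ∈ T; and (c) whenever w ∈ T and v ∈ Λ⁰ satisfy vΛw ≠ ∅, one has v ∈ T. -/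
namespace KGraph

variable {k : ℕ} (Λ : KGraph k)

variable {Λ}

/-- A path with source `x(p)` can be extended along `x` to one with source `x(q)`, for `p ≤ q`. -/
theorem InfPath.exists_extension (x : Λ.InfPath) {p q : Fin k → ℕ} (hpq : p ≤ q) {lam : Λ.Mor}
    (hs : Λ.s lam = x.vertex p) :
    ∃ μ, Λ.r μ = Λ.r lam ∧ Λ.s μ = x.vertex q ∧ Λ.d μ = Λ.d lam + (q - p) := by
  have h : Λ.s lam = Λ.r (x.seg p q hpq) := by rw [hs, x.r_seg]; rfl
  refine ⟨Λ.comp lam (x.seg p q hpq) h, Λ.r_comp _ _ _, ?_, ?_⟩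
  · rw [Λ.s_comp, x.s_seg]
    rfl
  · rw [Λ.d_comp, x.deg_seg]
    rfl

/-- Let `Λ` be a row-finite `k`-graph with no sources and `x ∈ Λ^∞` an
infinite path.  Then `T := { r(y) : y ∈ [x] } = { r(λ) : p ∈ ℕ^k, λ ∈ Λ, s(λ) = x(p) }`
(the ranges of the members of the shift-tail equivalence class of `x`) is a maximal tail
of `Λ`: it is a nonempty set of vertices satisfying (a), (b), (c). -/
theorem ranges_of_shiftTail_class_is_maximalTail
    {k : ℕ} (Λ : KGraph k) (hrf : Λ.RowFinite) (hns : Λ.NoSources)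
    (x : Λ.InfPath) (T : Set Λ.Mor)
    (hT : T = {v | ∃ (p : Fin k → ℕ) (lam : Λ.Mor),
      Λ.s lam = x.vertex p ∧ v = Λ.r lam}) :
    T.Nonempty ∧ (∀ v ∈ T, Λ.d v = 0) ∧
    (∀ v₁ ∈ T, ∀ v₂ ∈ T, ∃ w ∈ T,
      (∃ lam, Λ.r lam = v₁ ∧ Λ.s lam = w) ∧ (∃ lam, Λ.r lam = v₂ ∧ Λ.s lam = w)) ∧
    (∀ v ∈ T, ∀ i : Fin k,
      ∃ e, Λ.r e = v ∧ Λ.d e = Pi.single i 1 ∧ Λ.s e ∈ T) ∧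
    (∀ w ∈ T, ∀ v, Λ.d v = 0 → (∃ lam, Λ.r lam = v ∧ Λ.s lam = w) → v ∈ T) := by
  subst hT
  refine ⟨⟨_, 0, x.vertex 0, x.s_seg _ _ _, rfl⟩, ?_, ?_, ?_, ?_⟩
  · rintro _ ⟨p, lam, -, rfl⟩
    exact Λ.d_r lam
  · rintro _ ⟨p, lam, hp, rfl⟩ _ ⟨q, μ, hq, rfl⟩
    obtain ⟨α, hαr, hαs, -⟩ := x.exists_extension (le_sup_left : p ≤ p ⊔ q) hp
    obtain ⟨β, hβr, hβs, -⟩ := x.exists_extension (le_sup_right : q ≤ p ⊔ q) hq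
    exact ⟨x.vertex (p ⊔ q), ⟨p ⊔ q, x.vertex (p ⊔ q), x.s_seg _ _ _, (x.r_seg _ _ _).symm⟩,
      ⟨α, hαr, hαs⟩, ⟨β, hβr, hβs⟩⟩
  · rintro _ ⟨p, lam, hp, rfl⟩ i
    obtain ⟨α, hαr, hαs, hαd⟩ := x.exists_extension (q := p + Pi.single i 1) le_self_add hp
    rw [add_tsub_cancel_left, add_comm] at hαd
    obtain ⟨⟨e, ν⟩, ⟨h, he, -, rfl⟩, -⟩ := Λ.factor α _ _ hαd
    rw [Λ.r_comp] at hαr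
    rw [Λ.s_comp] at hαs
    exact ⟨e, hαr, he, _, ν, hαs, h⟩
  · rintro _ ⟨p, lam, hp, rfl⟩ _ - ⟨μ, rfl, hμ⟩
    exact ⟨p, Λ.comp μ lam hμ, (Λ.s_comp _ _ _).trans hp, (Λ.r_comp _ _ _).symm⟩

end KGraph
end
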